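/- Let p be an odd prime, q = p^m a power of p, and suppose q = 2^a·b − 1 with b odd and a ≥ 2. Let r ≥ 3 and n = 2^r. Then the set T_n = {0, 2^{r−1}, 2^{r−2}} ∪ ⋃_{i=3}^r { 2^{r−i}·s : s ∈ E_i } is a complete set of representatives of the q-cyclotomic cosets modulo 2^r: the cosets C_(t,2^r) for t ∈ T_n are pairwise disjoint and their union is all of Z/2^rZ. -/

import Mathlib

/-- The `q`-cyclotomic coset of the integer `t` modulo `n`, viewed inside `ZMod n`:
`C_(t,n) = { t·q^k mod n : k ≥ 0 }`. -/
def cycCoset (q n : ℕ) (t : ℤ) : Set (ZMod n) :=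
  {z | ∃ k : ℕ, z = (t : ZMod n) * (q : ZMod n) ^ k}

/-- If `x = 1 + 2^e * c` with `c` odd and `e ≥ 2`, then `x ^ 2^j - 1` has `2`-adic valuation
exactly `e + j`. -/
lemma exists_odd_pow_two_pow_eq {x : ℤ} {e : ℕ} (he : 2 ≤ e)
    (hx : ∃ c : ℤ, Odd c ∧ x = 1 + 2 ^ e * c) (j : ℕ) :
    ∃ c : ℤ, Odd c ∧ x ^ 2 ^ j = 1 + 2 ^ (e + j) * c := by
  induction j with
  | zero => simpa using hx
  | succ j ih =>
    obtain ⟨c, hc, h⟩ := ih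
    obtain ⟨f, rfl⟩ : ∃ f, e = f + 2 := ⟨e - 2, by omega⟩
    refine ⟨c + 2 ^ (f + j + 1) * c ^ 2, ?_, ?_⟩
    · refine hc.add_even (Even.mul_right ?_ _)
      rw [pow_succ]
      exact even_two.mul_left _
    · rw [pow_succ, pow_mul, h]
      ring

/-- If `x - 1` has `2`-adic valuation exactly `e ≥ 2`, then every integer congruent modulo `2^e`
to an odd `w` is congruent, modulo any power of `2`, to some `w * x ^ k`. -/
lemma exists_two_pow_dvd_mul_pow_sub {x w u : ℤ} {e : ℕ} (he : 2 ≤ e)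
    (hx : ∃ c : ℤ, Odd c ∧ x = 1 + 2 ^ e * c) (hw : Odd w) (hu : 2 ^ e ∣ w - u) (j : ℕ) :
    ∃ k : ℕ, 2 ^ (e + j) ∣ w * x ^ k - u := by
  have hxo : Odd x := by
    obtain ⟨c, -, rfl⟩ := hx
    refine odd_one.add_even (Even.mul_right ?_ _)
    exact even_two.pow_of_ne_zero (by omega)
  induction j with
  | zero => exact ⟨0, by simpa using hu⟩
  | succ j ih =>
    obtain ⟨k, d, hd⟩ := ih
    rcases Int.even_or_odd d with hde | hdo
    · obtain ⟨f, rfl⟩ := hde.two_dvd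
      exact ⟨k, f, by rw [hd]; ring⟩
    · obtain ⟨c, hc, h⟩ := exists_odd_pow_two_pow_eq he hx j
      obtain ⟨f, hf⟩ := (hdo.add_odd ((hw.mul (hxo.pow (n := k))).mul hc)).two_dvd
      refine ⟨k + 2 ^ j, f, ?_⟩
      rw [pow_add, h]
      linear_combination hd + 2 ^ (e + j) * hf

lemma exists_odd_nine_eq : ∃ c : ℤ, Odd c ∧ (9 : ℤ) = 1 + 2 ^ 3 * c := ⟨1, odd_one, by norm_num⟩

/-- The multiplicative order of `3` modulo `2 ^ n` is `2 ^ (n - 2)` for `n ≥ 3`. -/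
lemma orderOf_three_zmod_two_pow (j : ℕ) :
    orderOf (3 : ZMod (2 ^ (j + 3))) = 2 ^ (j + 1) := by
  have key (i : ℕ) (x : ℤ) : ((x : ZMod (2 ^ i)) = 1) ↔ (2 : ℤ) ^ i ∣ x - 1 := by
    have := ZMod.intCast_eq_intCast_iff_dvd_sub 1 x (2 ^ i)
    push_cast at this
    rw [← this, eq_comm]
  have pow3 (n : ℕ) : (3 : ZMod (2 ^ (j + 3))) ^ n = ((3 ^ n : ℤ) : ZMod (2 ^ (j + 3))) := by
    push_cast; rfl
  refine orderOf_eq_prime_pow ?_ ?_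
  · rw [pow3, key]
    rcases j with _ | j
    · norm_num
    · obtain ⟨c, hc, h⟩ := exists_odd_pow_two_pow_eq (by norm_num) exists_odd_nine_eq j
      have h3 : (3 : ℤ) ^ 2 ^ (j + 1) = 9 ^ 2 ^ j := by
        rw [pow_succ', pow_mul]; norm_num
      rw [h3, h, add_sub_cancel_left, show j + 1 + 3 = 3 + j + 1 by ring, pow_succ]
      rw [mul_dvd_mul_iff_left (by positivity)]
      exact fun hd => Int.not_even_iff_odd.2 hc (even_iff_two_dvd.2 hd)
  · rw [pow3, key]
    obtain ⟨c, -, h⟩ := exists_odd_pow_two_pow_eq (by norm_num) exists_odd_nine_eq j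
    have h3 : (3 : ℤ) ^ 2 ^ (j + 1) = 9 ^ 2 ^ j := by
      rw [pow_succ', pow_mul]; norm_num
    rw [h3, h, add_sub_cancel_left, add_comm]
    exact dvd_mul_right _ _

lemma two_pow_dvd_three_pow_sub_iff (j v w : ℕ) :
    (2 : ℤ) ^ (j + 3) ∣ 3 ^ w - 3 ^ v ↔ v ≡ w [MOD 2 ^ (j + 1)] := by
  have h := ZMod.intCast_eq_intCast_iff_dvd_sub (3 ^ v) (3 ^ w) (2 ^ (j + 3))
  push_cast at h
  have hu : IsUnit (3 : ZMod (2 ^ (j + 3))) := by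
    refine IsUnit.of_pow_eq_one (n := 2 ^ (j + 1)) ?_ (by positivity)
    rw [← orderOf_three_zmod_two_pow j, pow_orderOf_eq_one]
  obtain ⟨y, hy⟩ := hu
  rw [← h, ← orderOf_three_zmod_two_pow j, ← hy, orderOf_units, ← pow_eq_pow_iff_modEq]
  norm_cast

lemma three_pow_emod_eight (v : ℕ) : (3 : ℤ) ^ v % 8 = 1 ∨ (3 : ℤ) ^ v % 8 = 3 := by
  induction v with
  | zero => simp
  | succ v ih => rw [pow_succ]; omega

/-- The odd parts `u` of the representatives `2 ^ (r - i) * u`. -/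
def IsOddRep (a i : ℕ) (u : ℤ) : Prop :=
  if a = 2 ∧ 3 ≤ i then u = 1 ∨ u = -1 else ∃ v < 2 ^ (min i (a + 1) - 2), u = 3 ^ v

lemma IsOddRep.odd {a i : ℕ} {u : ℤ} (h : IsOddRep a i u) : Odd u := by
  unfold IsOddRep at h
  split_ifs at h
  · rcases h with rfl | rfl <;> decide
  · obtain ⟨v, -, rfl⟩ := h
    exact Odd.pow (by decide)

/-- Uniqueness of the odd representative modulo `2 ^ i`. -/
lemma IsOddRep.eq_of_dvd {a i k : ℕ} {b Q u w : ℤ} (hb : Odd b) (ha : 2 ≤ a)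
    (hQ : Q = 2 ^ a * b - 1) (hu : IsOddRep a i u) (hw : IsOddRep a i w)
    (h : 2 ^ i ∣ u * Q ^ k - w) : u = w := by
  unfold IsOddRep at hu hw
  by_cases hi : 3 ≤ i
  · have h8 : (8 : ℤ) ∣ u * Q ^ k - w := (pow_dvd_pow 2 hi).trans h
    rcases eq_or_ne a 2 with rfl | ha2
    · simp only [hi, and_self, if_true] at hu hw
      obtain ⟨d, rfl⟩ := hb
      have hQk : Q ^ k % 8 = 1 ∨ Q ^ k % 8 = 3 := by
        have : Q ≡ 3 [ZMOD 8] := by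
          rw [Int.ModEq]; omega
        rw [(this.pow k).eq]
        exact three_pow_emod_eight k
      rcases hu with rfl | rfl <;> rcases hw with rfl | rfl <;> omega
    · simp only [ha2, false_and, if_false] at hu hw
      obtain ⟨v, hv, rfl⟩ := hu
      obtain ⟨v', hv', rfl⟩ := hw
      obtain ⟨g, rfl⟩ : ∃ g, a = g + 3 := ⟨a - 3, by omega⟩
      have hQ8 : Q ≡ -1 [ZMOD 8] :=
        ((Int.modEq_iff_dvd).2 ⟨2 ^ g * b, by rw [hQ]; ring⟩).symm
      rcases Nat.even_or_odd k with hk | hk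
      · obtain ⟨l, rfl⟩ := hk.two_dvd
        obtain ⟨j, hj⟩ : ∃ j, min i (g + 3 + 1) = j + 3 := ⟨min i (g + 3 + 1) - 3, by omega⟩
        rw [hj] at hv hv'
        have hQ2 : (2 : ℤ) ^ (j + 3) ∣ Q ^ (2 * l) - 1 := by
          refine (pow_dvd_pow 2 (show j + 3 ≤ g + 3 + 1 by omega)).trans ?_
          rw [pow_mul]
          refine Dvd.dvd.trans ?_ (sub_one_dvd_pow_sub_one (Q ^ 2) l)
          exact ⟨b * (2 ^ (g + 2) * b - 1), by rw [hQ]; ring⟩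
        have h1 : (2 : ℤ) ^ (j + 3) ∣ 3 ^ v - 3 ^ v' := by
          have h2 := (pow_dvd_pow (2 : ℤ) (show j + 3 ≤ i by omega)).trans h
          rw [show (3 : ℤ) ^ v - 3 ^ v' =
            3 ^ v * Q ^ (2 * l) - 3 ^ v' - 3 ^ v * (Q ^ (2 * l) - 1) by ring]
          exact dvd_sub h2 (hQ2.mul_left _)
        rw [two_pow_dvd_three_pow_sub_iff] at h1
        rw [h1.symm.eq_of_lt_of_lt hv hv']
      · exfalso
        have h1 := hQ8.pow k
        rw [hk.neg_one_pow] at h1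
        have h2 := (h1.mul_left (3 ^ v)).symm.dvd
        have h3 := three_pow_emod_eight v
        have h4 := three_pow_emod_eight v'
        omega
  · simp only [hi, and_false, if_false, show min i (a + 1) - 2 = 0 by omega, pow_zero,
      Nat.lt_one_iff, exists_eq_left] at hu hw
    rw [hu, hw]

/-- Existence of the odd representative modulo `2 ^ i`. -/
lemma exists_isOddRep {a i : ℕ} {b Q u : ℤ} (hb : Odd b) (ha : 2 ≤ a)
    (hQ : Q = 2 ^ a * b - 1) (hi0 : i ≠ 0) (hu : Odd u) :
    ∃ w k, IsOddRep a i w ∧ 2 ^ i ∣ w * Q ^ k - u := by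
  unfold IsOddRep
  have hQo : Odd Q := by
    rw [hQ]
    exact ((even_two.pow_of_ne_zero (by omega)).mul_right _).sub_odd odd_one
  have hQ4 : Q % 4 = 3 := by
    obtain ⟨g, rfl⟩ : ∃ g, a = g + 2 := ⟨a - 2, by omega⟩
    rw [show Q = 4 * (2 ^ g * b) - 1 by rw [hQ]; ring]
    omega
  obtain ⟨d, rfl⟩ := hu
  by_cases hi : 3 ≤ i
  · have hQ2 : ∃ c : ℤ, Odd c ∧ Q ^ 2 = 1 + 2 ^ (a + 1) * c := by
      obtain ⟨g, rfl⟩ : ∃ g, a = g + 2 := ⟨a - 2, by omega⟩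
      refine ⟨b * (2 ^ (g + 1) * b - 1), hb.mul ?_, by rw [hQ]; ring⟩
      exact ((even_two.pow_of_ne_zero (by omega)).mul_right _).sub_odd odd_one
    have lift {s : ℤ} (hs : Odd s) (ε : ℕ)
        (h : 2 ^ min i (a + 1) ∣ s * Q ^ ε - (2 * d + 1)) :
        ∃ k, 2 ^ i ∣ s * Q ^ k - (2 * d + 1) := by
      rcases le_total i (a + 1) with hia | hia
      · rw [min_eq_left hia] at h
        exact ⟨ε, h⟩
      · rw [min_eq_right hia] at h
        obtain ⟨k, hk⟩ := exists_two_pow_dvd_mul_pow_sub (by omega) hQ2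
          (hs.mul (hQo.pow (n := ε))) h (i - (a + 1))
        rw [Nat.add_sub_cancel' hia] at hk
        exact ⟨ε + 2 * k, by rwa [pow_add, pow_mul, ← mul_assoc]⟩
    rcases eq_or_ne a 2 with rfl | ha2
    · simp only [hi, and_self, if_true]
      rw [min_eq_right hi] at lift
      obtain ⟨c, rfl⟩ := hb
      have hsel : ∃ s : ℤ, (s = 1 ∨ s = -1) ∧ ∃ ε : ℕ, (2 : ℤ) ^ 3 ∣ s * Q ^ ε - (2 * d + 1) := by
        have : d % 4 = 0 ∨ d % 4 = 1 ∨ d % 4 = 2 ∨ d % 4 = 3 := by omega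
        rcases this with h | h | h | h
        · exact ⟨1, .inl rfl, 0, by simp only [pow_zero]; omega⟩
        · exact ⟨1, .inl rfl, 1, by simp only [pow_one]; omega⟩
        · exact ⟨-1, .inr rfl, 1, by simp only [pow_one]; omega⟩
        · exact ⟨-1, .inr rfl, 0, by simp only [pow_zero]; omega⟩
      obtain ⟨s, hs, ε, h⟩ := hsel
      obtain ⟨k, hk⟩ := lift (by rcases hs with rfl | rfl <;> decide) ε h
      exact ⟨s, k, hs, hk⟩
    · simp only [ha2, false_and, if_false]
      have hQ8 : Q % 8 = 7 := by
        obtain ⟨g, rfl⟩ : ∃ g, a = g + 3 := ⟨a - 3, by omega⟩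
        rw [show Q = 8 * (2 ^ g * b) - 1 by rw [hQ]; ring]
        omega
      obtain ⟨j, hj⟩ : ∃ j, min i (a + 1) = j + 3 := ⟨min i (a + 1) - 3, by omega⟩
      have hsel : ∃ δ ε : ℕ, (2 : ℤ) ^ 3 ∣ 3 ^ δ * Q ^ ε - (2 * d + 1) := by
        have : d % 4 = 0 ∨ d % 4 = 1 ∨ d % 4 = 2 ∨ d % 4 = 3 := by omega
        rcases this with h | h | h | h
        · exact ⟨0, 0, by simp only [pow_zero]; omega⟩
        · exact ⟨1, 0, by simp only [pow_zero, pow_one]; omega⟩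
        · exact ⟨1, 1, by simp only [pow_one]; omega⟩
        · exact ⟨0, 1, by simp only [pow_zero, pow_one]; omega⟩
      obtain ⟨δ, ε, h⟩ := hsel
      have h3 (n : ℕ) : Odd ((3 : ℤ) ^ n) := Odd.pow (by decide)
      obtain ⟨k, hk⟩ := exists_two_pow_dvd_mul_pow_sub (by norm_num) exists_odd_nine_eq
        ((h3 δ).mul (hQo.pow (n := ε))) h j
      have hv := (two_pow_dvd_three_pow_sub_iff j _ _).2 (Nat.mod_modEq (δ + 2 * k) (2 ^ (j + 1))).symm
      obtain ⟨l, hl⟩ := lift (h3 ((δ + 2 * k) % 2 ^ (j + 1))) ε (by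
        rw [hj]
        rw [add_comm 3 j] at hk
        have hadd := dvd_add hk (hv.mul_right (Q ^ ε))
        have h9 : (3 : ℤ) ^ (δ + 2 * k) = 3 ^ δ * 9 ^ k := by
          rw [pow_add, pow_mul]
          norm_num
        rw [h9] at hadd
        rwa [show ∀ x : ℤ, x * Q ^ ε - (2 * d + 1) = 3 ^ δ * Q ^ ε * 9 ^ k - (2 * d + 1) +
          (x - 3 ^ δ * 9 ^ k) * Q ^ ε by intro x; ring])
      exact ⟨_, l, ⟨_, by rw [hj]; exact Nat.mod_lt _ (by positivity), rfl⟩, hl⟩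
  · simp only [hi, and_false, if_false, show min i (a + 1) - 2 = 0 by omega, pow_zero,
      Nat.lt_one_iff, exists_eq_left]
    obtain rfl | rfl : i = 1 ∨ i = 2 := by omega
    · exact ⟨1, 0, rfl, by simp only [pow_zero, pow_one]; omega⟩
    · rcases Int.even_or_odd d with ⟨c, rfl⟩ | ⟨c, rfl⟩
      · exact ⟨1, 0, rfl, by simp only [pow_zero]; omega⟩
      · exact ⟨1, 1, rfl, by simp only [pow_one]; omega⟩

/-- The set of representatives in the statement, described uniformly. -/
lemma mem_reps_iff {a r : ℕ} (ha : 2 ≤ a) (hr : 3 ≤ r) (E : ℕ → Set ℤ)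
    (hE : ∀ i, 3 ≤ i → i ≤ r →
      E i = if a = 2 then {1, -1}
        else if i ≤ a then {x : ℤ | ∃ v : ℕ, v ≤ 2 ^ (i - 2) - 1 ∧ x = 3 ^ v}
        else {x : ℤ | ∃ v : ℕ, v ≤ 2 ^ (a - 1) - 1 ∧ x = 3 ^ v}) (t : ℤ) :
    t ∈ ({0, 2 ^ (r - 1), 2 ^ (r - 2)} ∪
        ⋃ i ∈ Set.Icc 3 r, (fun u : ℤ => 2 ^ (r - i) * u) '' E i : Set ℤ) ↔
      t = 0 ∨ ∃ i u, i ≠ 0 ∧ i ≤ r ∧ IsOddRep a i u ∧ t = 2 ^ (r - i) * u := by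
  have hmem (i : ℕ) (h3 : 3 ≤ i) (hi : i ≤ r) (u : ℤ) : u ∈ E i ↔ IsOddRep a i u := by
    have hlt (v n : ℕ) : v ≤ 2 ^ n - 1 ↔ v < 2 ^ n := by
      have := Nat.two_pow_pos n
      omega
    rw [hE i h3 hi, IsOddRep]
    by_cases ha2 : a = 2
    · simp [ha2, h3]
    · by_cases hia : i ≤ a
      · simp [ha2, hia, hlt, min_eq_left (show i ≤ a + 1 by omega)]
      · simp [ha2, hia, hlt, min_eq_right (show a + 1 ≤ i by omega)]
  have hsmall (i : ℕ) (h3 : i < 3) (u : ℤ) : IsOddRep a i u ↔ u = 1 := by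
    simp [IsOddRep, show ¬ 3 ≤ i by omega, show min i (a + 1) - 2 = 0 by omega]
  simp only [Set.mem_union, Set.mem_insert_iff, Set.mem_singleton_iff, Set.mem_iUnion,
    Set.mem_image, Set.mem_Icc, exists_prop]
  constructor
  · rintro ((rfl | rfl | rfl) | ⟨i, ⟨h3, hi⟩, u, hu, rfl⟩)
    · exact .inl rfl
    · exact .inr ⟨1, 1, by omega, by omega, (hsmall _ (by omega) _).2 rfl, by ring⟩
    · exact .inr ⟨2, 1, by omega, by omega, (hsmall _ (by omega) _).2 rfl, by ring⟩
    · exact .inr ⟨i, u, by omega, hi, (hmem i h3 hi u).1 hu, rfl⟩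
  · rintro (rfl | ⟨i, u, h0, hi, hu, rfl⟩)
    · exact .inl (.inl rfl)
    · by_cases h3 : 3 ≤ i
      · exact .inr ⟨i, ⟨h3, hi⟩, u, (hmem i h3 hi u).2 hu, rfl⟩
      · rw [hsmall i (by omega)] at hu
        subst hu
        obtain rfl | rfl : i = 1 ∨ i = 2 := by omega
        · exact .inl (.inr (.inl (by ring)))
        · exact .inl (.inr (.inr (by ring)))

lemma two_pow_not_dvd_mul_odd {r i : ℕ} (h0 : i ≠ 0) (hi : i ≤ r) {u : ℤ} (hu : Odd u) :
    ¬ (2 : ℤ) ^ r ∣ 2 ^ (r - i) * u := by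
  intro h
  obtain ⟨s, rfl⟩ := Nat.exists_eq_add_of_le hi
  rw [Nat.add_sub_cancel_left, add_comm, pow_add, mul_dvd_mul_iff_left (by positivity)] at h
  exact Int.not_even_iff_odd.2 hu (even_iff_two_dvd.2 ((dvd_pow_self 2 h0).trans h))

/-- If `2 ^ r ∣ 2 ^ (r - i) * u - 2 ^ (r - j) * w` with `w` odd, comparing
`2`-adic valuations gives `j ≤ i`. -/
lemma le_of_two_pow_dvd {r i j : ℕ} (hi : i ≤ r) (hj : j ≤ r) {u w : ℤ} (hw : Odd w)
    (h : (2 : ℤ) ^ r ∣ 2 ^ (r - i) * u - 2 ^ (r - j) * w) : j ≤ i := by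
  by_contra! hij
  have h1 : (2 : ℤ) ^ (r - i) ∣ 2 ^ (r - j) * w := by
    have := (pow_dvd_pow (2 : ℤ) (Nat.sub_le r i)).trans h
    exact (dvd_sub_right (dvd_mul_right _ _)).1 this
  have h2 := two_pow_not_dvd_mul_odd (r := r - i) (i := j - i) (by omega) (by omega) hw
  rw [show r - i - (j - i) = r - j by omega] at h2
  exact h2 h1

/-- for `q = p^m = 2^a·b − 1` (`p` odd prime, `b` odd, `a ≥ 2`) and `r ≥ 3`,
the set `T_n = {0, 2^{r−1}, 2^{r−2}} ∪ ⋃_{i=3}^r {2^{r−i}·s : s ∈ E_i}` is a complete set of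
representatives of the `q`-cyclotomic cosets modulo `2^r`. -/
theorem stmt1 (p m a b r : ℕ) (hp : p.Prime) (hpodd : Odd p) (hm : 0 < m)
    (hb : Odd b) (ha : 2 ≤ a) (hq : (p : ℤ) ^ m = 2 ^ a * b - 1) (hr : 3 ≤ r)
    (E : ℕ → Set ℤ)
    (hE : ∀ i, 3 ≤ i → i ≤ r →
      E i = if a = 2 then {1, -1}
        else if i ≤ a then {x : ℤ | ∃ v : ℕ, v ≤ 2 ^ (i - 2) - 1 ∧ x = 3 ^ v}
        else {x : ℤ | ∃ v : ℕ, v ≤ 2 ^ (a - 1) - 1 ∧ x = 3 ^ v})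
    (Tn : Set ℤ)
    (hTn : Tn = {0, 2 ^ (r - 1), 2 ^ (r - 2)} ∪
        ⋃ i ∈ Set.Icc 3 r, (fun u : ℤ => 2 ^ (r - i) * u) '' E i) :
    Tn.Pairwise (fun t₁ t₂ =>
        Disjoint (cycCoset (p ^ m) (2 ^ r) t₁) (cycCoset (p ^ m) (2 ^ r) t₂)) ∧
      ⋃ t ∈ Tn, cycCoset (p ^ m) (2 ^ r) t = Set.univ := by
  subst hTn
  have hbZ : Odd (b : ℤ) := by exact_mod_cast hb
  have hQo : Odd ((p : ℤ) ^ m) := by exact_mod_cast hpodd.pow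
  have hcast (x y : ℤ) :
      ((x : ZMod (2 ^ r)) = (y : ZMod (2 ^ r))) ↔ (2 : ℤ) ^ r ∣ x - y := by
    have := ZMod.intCast_eq_intCast_iff_dvd_sub y x (2 ^ r)
    push_cast at this
    rw [← this, eq_comm]
  have hterm (t : ℤ) (k : ℕ) : (t : ZMod (2 ^ r)) * ((p ^ m : ℕ) : ZMod (2 ^ r)) ^ k =
      ((t * ((p : ℤ) ^ m) ^ k : ℤ) : ZMod (2 ^ r)) := by
    push_cast
    rfl
  constructor
  · intro t₁ h₁ t₂ h₂ hne
    rw [Set.disjoint_left]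
    rintro z ⟨k, rfl⟩ ⟨l, h⟩
    rw [hterm, hterm, hcast] at h
    apply hne
    clear hne
    rw [mem_reps_iff ha hr E hE] at h₁ h₂
    wlog hkl : l ≤ k generalizing t₁ t₂ k l
    · exact (this h₂ h₁ l k (by rwa [dvd_sub_comm]) (by omega)).symm
    obtain ⟨n, rfl⟩ := Nat.exists_eq_add_of_le hkl
    have hn : (2 : ℤ) ^ r ∣ t₁ * ((p : ℤ) ^ m) ^ n - t₂ := by
      have hco : IsCoprime ((2 : ℤ) ^ r) (((p : ℤ) ^ m) ^ l) := by
        refine IsCoprime.pow ?_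
        exact Int.isCoprime_two_left.2 hQo
      refine hco.dvd_of_dvd_mul_left ?_
      rw [show ((p : ℤ) ^ m) ^ l * (t₁ * ((p : ℤ) ^ m) ^ n - t₂) =
        t₁ * ((p : ℤ) ^ m) ^ (l + n) - t₂ * ((p : ℤ) ^ m) ^ l by ring]
      exact h
    rcases h₁ with rfl | ⟨i, u, hi0, hi, hu, rfl⟩ <;> rcases h₂ with rfl | ⟨j, w, hj0, hj, hw, rfl⟩
    · rfl
    · rw [zero_mul, zero_sub, dvd_neg] at hn
      exact absurd hn (two_pow_not_dvd_mul_odd hj0 hj hw.odd)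
    · rw [sub_zero, mul_assoc] at hn
      exact absurd hn (two_pow_not_dvd_mul_odd hi0 hi (hu.odd.mul hQo.pow))
    · rw [mul_assoc] at hn
      obtain rfl : i = j := le_antisymm
        (le_of_two_pow_dvd hj hi (hu.odd.mul hQo.pow) (by rwa [dvd_sub_comm]))
        (le_of_two_pow_dvd hi hj hw.odd hn)
      rw [← mul_sub] at hn
      nth_rewrite 1 [← Nat.sub_add_cancel hi] at hn
      rw [pow_add, mul_dvd_mul_iff_left (by positivity)] at hn
      rw [hu.eq_of_dvd hbZ ha hq hw hn]
  · rw [Set.eq_univ_iff_forall]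
    intro z
    obtain ⟨y, rfl⟩ := ZMod.intCast_surjective z
    simp only [Set.mem_iUnion, exists_prop, mem_reps_iff ha hr E hE]
    by_cases hy : (2 : ℤ) ^ r ∣ y
    · refine ⟨0, .inl rfl, 0, ?_⟩
      rw [hterm, hcast]
      simpa using hy
    · have hy0 : y ≠ 0 := by
        rintro rfl
        exact hy (dvd_zero _)
      obtain ⟨e, u, hu, rfl⟩ : ∃ (e : ℕ) (u : ℤ), Odd u ∧ y = 2 ^ e * u := by
        have hfin : FiniteMultiplicity (2 : ℤ) y :=
          Int.finiteMultiplicity_iff.2 ⟨by decide, hy0⟩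
        obtain ⟨u, h, hu⟩ := hfin.exists_eq_pow_mul_and_not_dvd
        exact ⟨_, u, by rwa [← Int.not_even_iff_odd, even_iff_two_dvd], h⟩
      have her : e < r := by
        by_contra! hre
        exact hy ((pow_dvd_pow 2 hre).mul_right u)
      obtain ⟨w, k, hw, hk⟩ := exists_isOddRep (i := r - e) hbZ ha hq (by omega) hu
      refine ⟨2 ^ e * w, .inr ⟨r - e, w, by omega, by omega, hw, ?_⟩, k, ?_⟩
      · rw [Nat.sub_sub_self her.le]
      · rw [hterm, hcast, dvd_sub_comm, mul_assoc, ← mul_sub]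
        nth_rewrite 1 [← Nat.add_sub_cancel' her.le]
        rw [pow_add]
        exact mul_dvd_mul_left _ hk
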